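/- Let N be a network on n nodes with γ protocols and nonnegative cost function w, and let S, D be nodes. If a feasible path from S to D exists, then the infimum of w(P) over all feasible paths P from S to D is attained by a feasible path whose maximum stack height is at most γ·n² protocols; in particular, a cost-minimal (shortest) feasible path from S to D exists that reaches a maximum stack height of at most γ·n². -/

import Mathlib

/-- An adaptation function over a protocol set `A`: a conversion `(a→b)`,
an encapsulation `(a→ab)`, or a decapsulation `(a→ab)‾`. -/
inductive AdaptFun (A : Type) where
  | conv : A → A → AdaptFun A
  | encap : A → A → AdaptFun A
  | decap : A → A → AdaptFun A
deriving DecidableEq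

/-- The partial action of an adaptation function on a protocol stack
(a list whose head is the top of the stack). -/
def AdaptFun.apply {A : Type} [DecidableEq A] : AdaptFun A → List A → Option (List A)
  | .conv a b, x :: T => if x = a then some (b :: T) else none
  | .encap a b, x :: T => if x = a then some (b :: a :: T) else none
  | .decap a b, y :: x :: T => if y = b ∧ x = a then some (a :: T) else none
  | _, _ => none

/-- A network: a symmetric directed graph on node set `V`, adaptation functions `F U`
available at each node, receivable protocols `In U`, and a nonnegative cost function `w`. -/
structure Network (A V : Type) where
  E : V → V → Prop
  symm : ∀ u v, E u v ↔ E v u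
  F : V → Set (AdaptFun A)
  In : V → Set A
  w : V → AdaptFun A → V → ℝ
  w_nonneg : ∀ u f v, 0 ≤ w u f v

/-- A path `S f₀ U₁ f₁ … U_ℓ f_ℓ D`: `len` is `ℓ`, `nodes i` is `U_i`
(with `nodes 0 = S` and `nodes (ℓ+1) = D`), and `funs i` is `f_i`. -/
structure NetPath (A V : Type) where
  len : ℕ
  nodes : ℕ → V
  funs : ℕ → AdaptFun A

/-- The stack sequence of a path: `H₀ = [x]` where `f₀` is the conversion `(x→x)`,
and `H_i = f_i (H_{i-1})`. -/
def NetPath.stack {A V : Type} [DecidableEq A] (P : NetPath A V) : ℕ → Option (List A)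
  | 0 =>
    match P.funs 0 with
    | .conv a b => if a = b then some [a] else none
    | _ => none
  | i + 1 => (P.stack i).bind (P.funs (i + 1)).apply

/-- Feasibility of a path from `S` to `D` in the network `N`. -/
def Feasible {A V : Type} [DecidableEq A] (N : Network A V) (S D : V)
    (P : NetPath A V) : Prop :=
  P.nodes 0 = S ∧ P.nodes (P.len + 1) = D ∧
  (∀ i ≤ P.len, N.E (P.nodes i) (P.nodes (i + 1))) ∧
  (∀ i, 1 ≤ i → i ≤ P.len → P.funs i ∈ N.F (P.nodes i)) ∧
  (∃ x, P.funs 0 = .conv x x) ∧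
  (∀ i ≤ P.len, (P.stack i).isSome) ∧
  (∃ y ∈ N.In D, P.stack P.len = some [y])

/-- The cost of a path: `w(P) = Σ_{i=0}^{ℓ} w(U_i, f_i, U_{i+1})`. -/
def pathCost {A V : Type} (N : Network A V) (P : NetPath A V) : ℝ :=
  ∑ i ∈ Finset.range (P.len + 1), N.w (P.nodes i) (P.funs i) (P.nodes (i + 1))

/-- The maximum stack height `max_i |H_i|` reached along a path. -/
def NetPath.maxHeight {A V : Type} [DecidableEq A] (P : NetPath A V) : ℕ :=
  (Finset.range (P.len + 1)).sup fun i => ((P.stack i).map List.length).getD 0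

instance AdaptFun.instFinite {A : Type} [Finite A] : Finite (AdaptFun A) :=
  Finite.of_surjective
    (fun s : (A × A) ⊕ (A × A) ⊕ (A × A) => match s with
      | .inl p => AdaptFun.conv p.1 p.2
      | .inr (.inl p) => AdaptFun.encap p.1 p.2
      | .inr (.inr p) => AdaptFun.decap p.1 p.2)
    (by
      rintro (⟨a, b⟩ | ⟨a, b⟩ | ⟨a, b⟩)
      · exact ⟨.inl (a, b), rfl⟩
      · exact ⟨.inr (.inl (a, b)), rfl⟩
      · exact ⟨.inr (.inr (a, b)), rfl⟩)

section Stacks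

variable {A : Type}

/-- Two nonempty stacks that differ by replacing, adding or removing the top symbol. -/
def StackAdj (H H' : List A) : Prop :=
  (∃ a b T, H = a :: T ∧ H' = b :: T) ∨ (∃ b, H ≠ [] ∧ H' = b :: H) ∨
    ∃ b, H' ≠ [] ∧ H = b :: H'

theorem StackAdj.symm {H H' : List A} (h : StackAdj H H') : StackAdj H' H := by
  rcases h with ⟨a, b, T, h, h'⟩ | h | h
  · exact .inl ⟨b, a, T, h', h⟩
  · exact .inr (.inr h)
  · exact .inr (.inl h)

theorem StackAdj.ne_nil {H H' : List A} (h : StackAdj H H') : H' ≠ [] := by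
  rcases h with ⟨a, b, T, -, rfl⟩ | ⟨b, -, rfl⟩ | ⟨b, h, -⟩
  · simp
  · simp
  · exact h

theorem StackAdj.length_le {H H' : List A} (h : StackAdj H H') :
    H'.length ≤ H.length + 1 := by
  rcases h with ⟨a, b, T, rfl, rfl⟩ | ⟨b, -, rfl⟩ | ⟨b, -, rfl⟩ <;> simp only [List.length_cons] <;> omega

theorem StackAdj.isSuffix {H H' s : List A} (h : StackAdj H H') (hs : s <:+ H)
    (hlt : s.length < H'.length) : s <:+ H' := by
  rcases h with ⟨a, b, T, rfl, rfl⟩ | ⟨b, -, rfl⟩ | ⟨b, -, rfl⟩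
  · rcases List.suffix_cons_iff.1 hs with rfl | hs
    · simp at hlt
    · exact hs.trans (List.suffix_cons b T)
  · exact hs.trans (List.suffix_cons b H)
  · rcases List.suffix_cons_iff.1 hs with rfl | hs
    · simp at hlt
    · exact hs

variable [DecidableEq A]

theorem AdaptFun.stackAdj_of_apply_eq_some {f : AdaptFun A} {H H' : List A}
    (h : f.apply H = some H') : StackAdj H H' := by
  rcases f with ⟨a, b⟩ | ⟨a, b⟩ | ⟨a, b⟩ <;> rcases H with _ | ⟨x, _ | ⟨y, T⟩⟩ <;>
    simp [AdaptFun.apply] at h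
  · exact .inl ⟨x, b, [], rfl, h.2.symm⟩
  · exact .inl ⟨x, b, y :: T, rfl, h.2.symm⟩
  · obtain ⟨rfl, rfl⟩ := h
    exact .inr (.inl ⟨b, by simp, rfl⟩)
  · obtain ⟨rfl, rfl⟩ := h
    exact .inr (.inl ⟨b, by simp, rfl⟩)
  · obtain ⟨⟨rfl, rfl⟩, rfl⟩ := h
    exact .inr (.inr ⟨x, by simp, rfl⟩)

/-- An adaptation function that keeps the symbol `a` of a stack in place does not depend on
the part of the stack below `a`. -/
theorem AdaptFun.apply_append_cons {f : AdaptFun A} {X X' T' : List A} {a : A}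
    (h : f.apply (X ++ a :: T') = some (X' ++ a :: T')) (T : List A) :
    f.apply (X ++ a :: T) = some (X' ++ a :: T) := by
  have key : ∀ Z : List A, Z ++ a :: T' = X' ++ a :: T' → Z = X' :=
    fun Z hZ => List.append_cancel_right hZ
  rcases f with ⟨c, d⟩ | ⟨c, d⟩ | ⟨c, d⟩
  · rcases X with _ | ⟨x, X⟩
    · simp only [List.nil_append, AdaptFun.apply, Option.ite_none_right_eq_some,
        Option.some.injEq] at h ⊢
      obtain ⟨rfl, h⟩ := h
      have hl := congrArg List.length h
      simp only [List.length_cons, List.length_append] at hl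
      obtain rfl : X' = [] := List.length_eq_zero_iff.1 (by omega)
      simp at h
      simp [h]
    · simp only [List.cons_append, AdaptFun.apply, Option.ite_none_right_eq_some,
        Option.some.injEq] at h ⊢
      obtain ⟨rfl, h⟩ := h
      rw [← key (d :: X) h]
      simp
  · rcases X with _ | ⟨x, X⟩
    · simp only [List.nil_append, AdaptFun.apply, Option.ite_none_right_eq_some,
        Option.some.injEq] at h ⊢
      obtain ⟨rfl, h⟩ := h
      rw [← key [d] h]
      simp
    · simp only [List.cons_append, AdaptFun.apply, Option.ite_none_right_eq_some,
        Option.some.injEq] at h ⊢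
      obtain ⟨rfl, h⟩ := h
      rw [← key (d :: x :: X) h]
      simp
  · rcases X with _ | ⟨x, _ | ⟨y, X⟩⟩
    · exfalso
      rcases T' with _ | ⟨z, T'⟩ <;> simp [AdaptFun.apply] at h
      have hl := congrArg List.length h.2
      simp at hl
      omega
    · simp only [List.cons_append, List.nil_append, AdaptFun.apply,
        Option.ite_none_right_eq_some, Option.some.injEq] at h ⊢
      obtain ⟨⟨rfl, rfl⟩, h⟩ := h
      rw [← key [] h]
      simp
    · simp only [List.cons_append, AdaptFun.apply, Option.ite_none_right_eq_some,
        Option.some.injEq] at h ⊢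
      obtain ⟨⟨rfl, rfl⟩, h⟩ := h
      rw [← key (y :: X) h]
      simp

end Stacks

section Levels

variable {A : Type}

theorem exists_last_visit_of_level {H : ℕ → List A} {k : ℕ} (h0 : (H 0).length ≤ k) (m : ℕ)
    (hadj : ∀ i < m, StackAdj (H i) (H (i + 1))) (hk : k ≤ (H m).length) :
    ∃ p ≤ m, (H p).length = k ∧ ∀ i, p ≤ i → i ≤ m → H p <:+ H i := by
  induction m with
  | zero =>
    refine ⟨0, le_rfl, le_antisymm h0 hk, fun i _ hi => ?_⟩
    rw [Nat.le_zero.1 hi]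
  | succ m ih =>
    rcases hk.eq_or_lt with hk | hk
    · refine ⟨m + 1, le_rfl, hk.symm, fun i h1 h2 => ?_⟩
      rw [le_antisymm h2 h1]
    · have hm := hadj m m.lt_succ_self
      obtain ⟨p, hp, hpk, hs⟩ := ih (fun i hi => hadj i (by omega))
        (by have := hm.length_le; omega)
      refine ⟨p, by omega, hpk, fun i h1 h2 => ?_⟩
      rcases h2.eq_or_lt with rfl | h2
      · exact hm.isSuffix (hs m hp le_rfl) (by omega)
      · exact hs i h1 (by omega)

theorem exists_next_visit_of_level {H : ℕ → List A} {k : ℕ} (m d : ℕ)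
    (hend : (H (m + d)).length ≤ k)
    (hadj : ∀ i < m + d, StackAdj (H i) (H (i + 1))) (hk : k ≤ (H m).length) :
    ∃ q, m ≤ q ∧ q ≤ m + d ∧ (H q).length = k ∧ ∀ i, m ≤ i → i ≤ q → H q <:+ H i := by
  obtain ⟨p, hp, hpk, hs⟩ := exists_last_visit_of_level (H := fun i => H (m + d - i)) (k := k)
    hend d (fun i hi => by
      have := (hadj (m + d - (i + 1)) (by omega)).symm
      rwa [show m + d - (i + 1) + 1 = m + d - i by omega] at this)
    (by simpa using hk)
  refine ⟨m + d - p, by omega, by omega, hpk, fun i h1 h2 => ?_⟩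
  have := hs (m + d - i) (by omega) (by omega)
  simpa [show m + d - (m + d - i) = i by omega] using this

end Levels

section Runs

variable {A V : Type}

/-- The cost of the `i`-th step after the initial conversion. -/
def stepCost (N : Network A V) (P : NetPath A V) (i : ℕ) : ℝ :=
  N.w (P.nodes (i + 1)) (P.funs (i + 1)) (P.nodes (i + 2))

theorem pathCost_eq (N : Network A V) (P : NetPath A V) :
    pathCost N P =
      N.w (P.nodes 0) (P.funs 0) (P.nodes 1) + ∑ i ∈ Finset.Ico 0 P.len, stepCost N P i := by
  rw [pathCost, Finset.sum_range_succ', add_comm, Nat.Ico_zero_eq_range]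
  rfl

variable [DecidableEq A]

/-- `ConfigRun N u H k c v H'`: in `N` the configuration `(v, H')` is reached from `(u, H)` by
`k` steps of total cost `c`, where a configuration is the current node with the incoming stack. -/
inductive ConfigRun (N : Network A V) (u : V) (H : List A) : ℕ → ℝ → V → List A → Prop
  | refl : ConfigRun N u H 0 0 u H
  | snoc {k : ℕ} {c : ℝ} {v v' : V} {H' H'' : List A} {f : AdaptFun A} :
      ConfigRun N u H k c v H' → N.E v v' → f ∈ N.F v → f.apply H' = some H'' →
        ConfigRun N u H (k + 1) (c + N.w v f v') v' H''

theorem ConfigRun.trans {N : Network A V} {u v z : V} {H H' H'' : List A} {k l : ℕ} {c d : ℝ}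
    (h : ConfigRun N u H k c v H') (h' : ConfigRun N v H' l d z H'') :
    ConfigRun N u H (k + l) (c + d) z H'' := by
  induction h' with
  | refl => simpa using h
  | snoc _ hE hF hf ih =>
    rw [← add_assoc, ← add_assoc]
    exact ih.snoc hE hF hf

theorem NetPath.stack_congr {P P' : NetPath A V} (k : ℕ)
    (h : ∀ i ≤ k, P.funs i = P'.funs i) : P.stack k = P'.stack k := by
  induction k with
  | zero => simp only [NetPath.stack, h 0 le_rfl]
  | succ k ih =>
    simp only [NetPath.stack, h (k + 1) le_rfl, ih fun i hi => h i (by omega)]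

theorem ConfigRun.exists_netPath {N : Network A V} {S u v : V} {x : A} {H : List A} {k : ℕ}
    {c : ℝ} (h : ConfigRun N u [x] k c v H) (hE : N.E S u) :
    ∃ P : NetPath A V, P.len = k ∧ P.nodes 0 = S ∧ P.nodes (k + 1) = v ∧
      (∀ i ≤ k, N.E (P.nodes i) (P.nodes (i + 1))) ∧
      (∀ i, 1 ≤ i → i ≤ k → P.funs i ∈ N.F (P.nodes i)) ∧
      P.funs 0 = .conv x x ∧ (∀ i ≤ k, (P.stack i).isSome) ∧ P.stack k = some H ∧
      pathCost N P = N.w S (.conv x x) u + c := by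
  induction h with
  | refl =>
    refine ⟨⟨0, fun i => if i = 0 then S else u, fun _ => .conv x x⟩, rfl, rfl, rfl, ?_, ?_, rfl,
      ?_, ?_, ?_⟩
    · intro i hi
      simpa [Nat.le_zero.1 hi] using hE
    · intro i h1 h2
      omega
    · intro i hi
      simp [Nat.le_zero.1 hi, NetPath.stack]
    · simp [NetPath.stack]
    · simp [pathCost]
  | @snoc k c v v' H' H'' f _ hvE hF hf ih =>
    obtain ⟨P, hlen, hS, hv, hPE, hPF, h0, hsome, hstack, hcost⟩ := ih
    let P' : NetPath A V := ⟨k + 1, fun i => if i ≤ k + 1 then P.nodes i else v',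
      fun i => if i ≤ k then P.funs i else f⟩
    have hn : ∀ i ≤ k + 1, P'.nodes i = P.nodes i := fun i hi => if_pos hi
    have hn' : P'.nodes (k + 2) = v' := if_neg (by omega)
    have hf' : ∀ i ≤ k, P'.funs i = P.funs i := fun i hi => if_pos hi
    have hfk : P'.funs (k + 1) = f := if_neg (by omega)
    have hst : ∀ i ≤ k, P'.stack i = P.stack i := fun i hi =>
      NetPath.stack_congr i fun j hj => hf' j (hj.trans hi)
    have hst' : P'.stack (k + 1) = some H'' := by
      simp only [NetPath.stack, hst k le_rfl, hstack, hfk, Option.bind_some, hf]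
    refine ⟨P', rfl, (hn 0 (by omega)).trans hS, hn', ?_, ?_, (hf' 0 (by omega)).trans h0, ?_,
      hst', ?_⟩
    · intro i hi
      rcases hi.eq_or_lt with rfl | hi
      · rw [hn _ le_rfl, hn', hv]
        exact hvE
      · rw [hn i (by omega), hn (i + 1) (by omega)]
        exact hPE i (by omega)
    · intro i h1 hi
      rcases hi.eq_or_lt with rfl | hi
      · rw [hn _ le_rfl, hfk, hv]
        exact hF
      · rw [hn i (by omega), hf' i (by omega)]
        exact hPF i h1 (by omega)
    · intro i hi
      rcases hi.eq_or_lt with rfl | hi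
      · simp [hst']
      · rw [hst i (by omega)]
        exact hsome i (by omega)
    · have hlen' : P'.len = k + 1 := rfl
      rw [pathCost, hlen', Finset.sum_range_succ, hn _ le_rfl, hfk, hn', hv, ← add_assoc,
        ← hcost, pathCost, hlen]
      congr 1
      refine Finset.sum_congr rfl fun i hi => ?_
      have hi := Finset.mem_range.1 hi
      rw [hn i (by omega), hn (i + 1) (by omega), hf' i (by omega)]

/-- The stack after step `i`, with the empty list in place of an undefined stack. -/
def NetPath.stackD (P : NetPath A V) (i : ℕ) : List A := (P.stack i).getD []

variable {N : Network A V} {S D : V} {P : NetPath A V}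

theorem Feasible.stack_eq (hP : Feasible N S D P) {i : ℕ} (hi : i ≤ P.len) :
    P.stack i = some (P.stackD i) := by
  obtain ⟨H, hH⟩ := Option.isSome_iff_exists.1 (hP.2.2.2.2.2.1 i hi)
  simp [NetPath.stackD, hH]

theorem Feasible.apply_eq (hP : Feasible N S D P) {i : ℕ} (hi : i < P.len) :
    (P.funs (i + 1)).apply (P.stackD i) = some (P.stackD (i + 1)) := by
  have h := hP.stack_eq (i := i + 1) hi
  rwa [NetPath.stack, hP.stack_eq hi.le, Option.bind_some] at h

theorem Feasible.stackD_zero (hP : Feasible N S D P) :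
    ∃ x, P.funs 0 = .conv x x ∧ P.stackD 0 = [x] := by
  obtain ⟨x, hx⟩ := hP.2.2.2.2.1
  exact ⟨x, hx, by simp [NetPath.stackD, NetPath.stack, hx]⟩

theorem Feasible.stackD_len (hP : Feasible N S D P) : ∃ y ∈ N.In D, P.stackD P.len = [y] := by
  obtain ⟨y, hy, h⟩ := hP.2.2.2.2.2.2
  exact ⟨y, hy, by simp [NetPath.stackD, h]⟩

theorem Feasible.stackAdj (hP : Feasible N S D P) {i : ℕ} (hi : i < P.len) :
    StackAdj (P.stackD i) (P.stackD (i + 1)) :=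
  AdaptFun.stackAdj_of_apply_eq_some (hP.apply_eq hi)

theorem Feasible.stackD_ne_nil (hP : Feasible N S D P) {i : ℕ} (hi : i ≤ P.len) :
    P.stackD i ≠ [] := by
  rcases i with _ | i
  · obtain ⟨x, -, hx⟩ := hP.stackD_zero
    simp [hx]
  · exact (hP.stackAdj hi).ne_nil

/-- Over a segment of a feasible path whose stacks all end in `a :: T'`, the same steps can be
performed with `T'` replaced by `T`. -/
theorem Feasible.configRun_append (hP : Feasible N S D P) {p d : ℕ} (hd : p + d ≤ P.len)
    {a : A} {T' : List A} (T : List A) {X : ℕ → List A}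
    (hX : ∀ i, p ≤ i → i ≤ p + d → P.stackD i = X i ++ a :: T') :
    ConfigRun N (P.nodes (p + 1)) (X p ++ a :: T) d (∑ i ∈ Finset.Ico p (p + d), stepCost N P i)
      (P.nodes (p + d + 1)) (X (p + d) ++ a :: T) := by
  induction d with
  | zero => simpa using ConfigRun.refl
  | succ d ih =>
    rw [← add_assoc, Finset.sum_Ico_succ_top (by omega)]
    refine (ih (by omega) fun i h1 h2 => hX i h1 (by omega)).snoc
      (hP.2.2.1 _ (by omega)) (hP.2.2.2.1 _ (by omega) (by omega))
      (AdaptFun.apply_append_cons (T' := T') ?_ T)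
    rw [← hX _ (by omega) (by omega), ← hX _ (by omega) (by omega)]
    exact hP.apply_eq (by omega)

theorem Feasible.configRun (hP : Feasible N S D P) {p d : ℕ} (hd : p + d ≤ P.len) :
    ConfigRun N (P.nodes (p + 1)) (P.stackD p) d (∑ i ∈ Finset.Ico p (p + d), stepCost N P i)
      (P.nodes (p + d + 1)) (P.stackD (p + d)) := by
  induction d with
  | zero => simpa using ConfigRun.refl
  | succ d ih =>
    rw [← add_assoc, Finset.sum_Ico_succ_top (by omega)]
    exact (ih (by omega)).snoc (hP.2.2.1 _ (by omega)) (hP.2.2.2.1 _ (by omega) (by omega))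
      (hP.apply_eq (by omega))

/-- Replacing the part of a feasible path between times `p` and `q` by its part between
`p'` and `q'`, during which the stack always ends in the stack of time `p'`. -/
theorem Feasible.exists_splice (hP : Feasible N S D P) {p p' q' q : ℕ} (hp : p ≤ p')
    (hpq : p' ≤ q') (hq : q' ≤ q) (hlen : q ≤ P.len)
    (hnp : P.nodes (p + 1) = P.nodes (p' + 1)) (hnq : P.nodes (q + 1) = P.nodes (q' + 1))
    {a : A} {T T' : List A} (hHp : P.stackD p = a :: T) (hHq : P.stackD q = a :: T)
    (hHp' : P.stackD p' = a :: T') (hHq' : P.stackD q' = a :: T')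
    (hsuf : ∀ i, p' ≤ i → i ≤ q' → a :: T' <:+ P.stackD i) :
    ∃ P' : NetPath A V, Feasible N S D P' ∧ pathCost N P' ≤ pathCost N P ∧
      P'.len = p + (q' - p') + (P.len - q) := by
  obtain ⟨x, hx, hx0⟩ := hP.stackD_zero
  obtain ⟨y, hy, hyl⟩ := hP.stackD_len
  have hex : ∀ i, ∃ X, p' ≤ i → i ≤ q' → P.stackD i = X ++ a :: T' := by
    intro i
    by_cases hi : p' ≤ i ∧ i ≤ q'
    · obtain ⟨X, hX⟩ := hsuf i hi.1 hi.2
      exact ⟨X, fun _ _ => hX.symm⟩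
    · exact ⟨[], fun h1 h2 => absurd ⟨h1, h2⟩ hi⟩
  choose X hX using hex
  have hXp : X p' = [] := by
    have := hX p' le_rfl hpq
    rw [hHp'] at this
    exact List.append_cancel_right (bs := a :: T') (by simpa using this.symm)
  have hXq : X q' = [] := by
    have := hX q' hpq le_rfl
    rw [hHq'] at this
    exact List.append_cancel_right (bs := a :: T') (by simpa using this.symm)
  have r1 := hP.configRun (p := 0) (d := p) (by omega)
  have r2 := hP.configRun_append (p := p') (d := q' - p') (by omega) T (X := X)
    (fun i h1 h2 => hX i h1 (by omega))
  have r3 := hP.configRun (p := q) (d := P.len - q) (by omega)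
  rw [Nat.add_sub_cancel' hpq, hXp, hXq, List.nil_append, ← hnp, ← hnq, ← hHp] at r2
  rw [hx0] at r1
  simp only [zero_add] at r1
  rw [Nat.add_sub_cancel' hlen, hyl, hHq, ← hHp] at r3
  obtain ⟨P', hl, h0, hend, hE, hF, hconv, hsome, hstack, hcost⟩ :=
    ((r1.trans r2).trans r3).exists_netPath (S := S) (by
      have := hP.2.2.1 0 (by omega)
      rwa [hP.1] at this)
  refine ⟨P', ⟨h0, ?_, ?_, ?_, ⟨x, hconv⟩, ?_, ⟨y, hy, ?_⟩⟩, ?_, hl⟩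
  · rw [hl, hend, hP.2.1]
  · rwa [hl]
  · rwa [hl]
  · rwa [hl]
  · rwa [hl]
  · rw [hcost, pathCost_eq, hP.1, hx,
      ← Finset.sum_Ico_consecutive _ (Nat.zero_le p) (by omega : p ≤ P.len),
      ← Finset.sum_Ico_consecutive _ hp (by omega : p' ≤ P.len),
      ← Finset.sum_Ico_consecutive _ hpq (by omega : q' ≤ P.len),
      ← Finset.sum_Ico_consecutive _ hq hlen]
    have hnn : ∀ s : Finset ℕ, 0 ≤ ∑ i ∈ s, stepCost N P i := fun s =>
      Finset.sum_nonneg fun i _ => N.w_nonneg _ _ _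
    have := hnn (Finset.Ico p p')
    have := hnn (Finset.Ico q' q)
    linarith

/-- A feasible path is tight if no feasible path of at most the same cost is shorter. -/
def IsTight (N : Network A V) (S D : V) (P : NetPath A V) : Prop :=
  Feasible N S D P ∧
    ∀ P' : NetPath A V, Feasible N S D P' → pathCost N P' ≤ pathCost N P → P.len ≤ P'.len

theorem Feasible.exists_isTight (hP : Feasible N S D P) :
    ∃ P' : NetPath A V, IsTight N S D P' ∧ pathCost N P' ≤ pathCost N P := by
  obtain ⟨P', ⟨hf, hc⟩, hmin⟩ := exists_minimalFor_of_wellFoundedLT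
    (fun Q => Feasible N S D Q ∧ pathCost N Q ≤ pathCost N P) NetPath.len ⟨P, hP, le_rfl⟩
  exact ⟨P', ⟨hf, fun Q hQ hQc => (le_total P'.len Q.len).elim id
    (hmin ⟨hQ, hQc.trans hc⟩)⟩, hc⟩

theorem IsTight.config_injOn (hP : IsTight N S D P) :
    Set.InjOn (fun i => (P.nodes (i + 1), P.stackD i)) (Set.Iic P.len) := by
  have key : ∀ p q, p < q → q ≤ P.len → P.nodes (p + 1) = P.nodes (q + 1) →
      P.stackD p ≠ P.stackD q := by
    intro p q hpq hq hn hs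
    obtain ⟨a, T, haT⟩ := List.exists_cons_of_ne_nil (hP.1.stackD_ne_nil hq)
    obtain ⟨P', hf, hc, hl⟩ := hP.1.exists_splice hpq.le le_rfl le_rfl hq hn rfl
      (hs.trans haT) haT haT haT (fun i h1 h2 => by rw [le_antisymm h2 h1, haT])
    have := hP.2 P' hf hc
    omega
  intro p hp q hq h
  simp only [Prod.mk.injEq] at h
  rcases lt_trichotomy p q with hlt | rfl | hlt
  · exact absurd h.2 (key p q hlt hq h.1)
  · rfl
  · exact absurd h.2.symm (key q p hlt hp h.1.symm)

theorem IsTight.length_stackD_le [Fintype A] [Fintype V] (hP : IsTight N S D P) {m : ℕ}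
    (hm : m ≤ P.len) : (P.stackD m).length ≤ Fintype.card A * Fintype.card V ^ 2 := by
  by_contra! hlt
  set B := Fintype.card A * Fintype.card V ^ 2 with hB
  have hlevel : ∀ k : Fin (B + 1), ∃ p q : ℕ, ∃ a T, T.length = (k : ℕ) ∧ p ≤ m ∧ m ≤ q ∧ q ≤ P.len ∧
      P.stackD p = a :: T ∧ P.stackD q = a :: T ∧
      ∀ i, p ≤ i → i ≤ q → a :: T <:+ P.stackD i := by
    intro k
    have hk : (k : ℕ) + 1 ≤ (P.stackD m).length := by omega
    obtain ⟨x, -, hx⟩ := hP.1.stackD_zero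
    obtain ⟨y, -, hy⟩ := hP.1.stackD_len
    obtain ⟨p, hpm, hpk, hps⟩ := exists_last_visit_of_level (H := P.stackD) (k := k + 1)
      (by simp [hx]) m (fun i hi => hP.1.stackAdj (by omega)) hk
    obtain ⟨q, hmq, hql, hqk, hqs⟩ := exists_next_visit_of_level (H := P.stackD) (k := k + 1)
      m (P.len - m) (by simp [Nat.add_sub_cancel' hm, hy])
      (fun i hi => hP.1.stackAdj (by omega)) hk
    have hpq : P.stackD p = P.stackD q :=
      (List.suffix_of_suffix_length_le (hps m hpm le_rfl) (hqs m le_rfl hmq)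
        (by omega)).eq_of_length (by omega)
    obtain ⟨a, T, haT⟩ := List.exists_cons_of_ne_nil (hP.1.stackD_ne_nil (hpm.trans hm))
    refine ⟨p, q, a, T, ?_, hpm, hmq, by omega, haT, hpq ▸ haT, fun i h1 h2 => ?_⟩
    · rw [haT] at hpk
      simpa using hpk
    · rcases le_total i m with him | him
      · exact haT ▸ hps i h1 him
      · exact haT ▸ hpq ▸ hqs i him h2
  choose p q a T hT hpm hmq hql hHp hHq hsuf using hlevel
  obtain ⟨k, k', hne, heq⟩ := Fintype.exists_ne_map_eq_of_card_lt
    (fun k => (a k, P.nodes (p k + 1), P.nodes (q k + 1))) (by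
      simp [hB, sq])
  wlog hkk : k < k' generalizing k k'
  · exact this k' k hne.symm heq.symm (lt_of_le_of_ne (not_lt.1 hkk) hne.symm)
  simp only [Prod.mk.injEq] at heq
  obtain ⟨ha, hnp, hnq⟩ := heq
  have hkk' : (k : ℕ) < k' := hkk
  have hpp : p k < p k' := by
    by_contra! h
    have := (hsuf k' (p k) h ((hpm k).trans (hmq k'))).length_le
    rw [hHp k] at this
    simp only [List.length_cons, hT] at this
    omega
  have hqq : q k' < q k := by
    by_contra! h
    have := (hsuf k' (q k) ((hpm k').trans (hmq k)) h).length_le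
    rw [hHq k] at this
    simp only [List.length_cons, hT] at this
    omega
  obtain ⟨P', hf, hc, hl⟩ := hP.1.exists_splice hpp.le ((hpm k').trans (hmq k')) hqq.le (hql k)
    hnp hnq (hHp k) (hHq k) (ha ▸ hHp k') (ha ▸ hHq k') (ha ▸ hsuf k')
  have := hP.2 P' hf hc
  have := hpm k'
  have := hmq k'
  have := hql k
  omega

theorem finite_pathCost_isTight [Fintype A] [Fintype V] (N : Network A V) (S D : V) :
    {c | ∃ P, IsTight N S D P ∧ pathCost N P = c}.Finite := by
  set B := Fintype.card A * Fintype.card V ^ 2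
  have hC : ((Set.univ : Set V) ×ˢ {H : List A | H.length ≤ B}).Finite :=
    Set.finite_univ.prod (List.finite_length_le A B)
  let L := hC.toFinset.card
  refine ((List.finite_length_le (V × AdaptFun A × V) L).image fun l =>
    (l.map fun t => N.w t.1 t.2.1 t.2.2).sum).subset ?_
  rintro c ⟨P, hP, rfl⟩
  refine ⟨(List.range (P.len + 1)).map fun i => (P.nodes i, P.funs i, P.nodes (i + 1)), ?_, ?_⟩
  · have hle : (Finset.range (P.len + 1)).card ≤ hC.toFinset.card :=
      Finset.card_le_card_of_injOn (fun i => (P.nodes (i + 1), P.stackD i))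
        (fun i hi => by
          have hi : i < P.len + 1 := by simpa using hi
          simpa using hP.length_stackD_le (Nat.lt_succ_iff.1 hi))
        (hP.config_injOn.mono fun i hi => by
          have hi : i < P.len + 1 := by simpa using hi
          exact Nat.lt_succ_iff.1 hi)
    simpa using hle
  · beta_reduce
    rw [pathCost, List.map_map]
    rfl

end Runs

/-- If a feasible path from `S` to `D` exists, then the infimum of the cost over all
feasible paths from `S` to `D` is attained by a feasible path whose maximum stack
height is at most `γ·n²`. -/
theorem exists_cost_minimal_feasible_path_maxHeight_le
    {A V : Type} [DecidableEq A] [Fintype A] [Fintype V]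
    (γ n : ℕ) (hγ : Fintype.card A = γ) (hn : Fintype.card V = n)
    (N : Network A V) (S D : V)
    (hex : ∃ P : NetPath A V, Feasible N S D P) :
    ∃ P : NetPath A V, Feasible N S D P ∧ P.maxHeight ≤ γ * n ^ 2 ∧
      ∀ Q : NetPath A V, Feasible N S D Q → pathCost N P ≤ pathCost N Q := by
  obtain ⟨P₀, hP₀⟩ := hex
  obtain ⟨P₁, hP₁, -⟩ := hP₀.exists_isTight
  obtain ⟨c, ⟨P, hP, rfl⟩, hmin⟩ :=
    (finite_pathCost_isTight N S D).exists_minimalFor id _ ⟨_, P₁, hP₁, rfl⟩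
  refine ⟨P, hP.1, Finset.sup_le fun i hi => ?_, fun Q hQ => ?_⟩
  · have hi : i ≤ P.len := Nat.lt_succ_iff.1 (Finset.mem_range.1 hi)
    rw [hP.1.stack_eq hi, ← hγ, ← hn]
    simpa using hP.length_stackD_le hi
  · obtain ⟨Q', hQ', hle⟩ := hQ.exists_isTight
    exact ((le_total _ _).elim id (hmin ⟨Q', hQ', rfl⟩)).trans hle
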